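/- arXiv:2001.07952 — 3 statements merged into one kernel-verified Lean document; each statement's English description precedes it below -/
import Mathlib

section
/- For every integer m ≥ 6, the m×m real symmetric matrix A (rows and columns indexed by 0,…,m−1) with entries A₀₀ = 10, A₀ⱼ = Aⱼ₀ = 4 for 1 ≤ j ≤ m−1, Aⱼⱼ = 0 for 1 ≤ j ≤ m−1, and Aᵢⱼ = 2 for all distinct i, j with 1 ≤ i, j ≤ m−1, has at least two nonnegative eigenvalues (eigenvalues counted with multiplicity as a real symmetric matrix). -/
open Matrix in
/-- If the quadratic form of a real symmetric matrix is nonnegative on the range of an injective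
linear map, then the matrix has at least as many nonnegative eigenvalues as the dimension of the
source. -/
theorem Matrix.IsHermitian.finrank_le_card_nonneg_eigenvalues {n V : Type*} [Fintype n]
    [DecidableEq n] [AddCommGroup V] [Module ℝ V] {A : Matrix n n ℝ}
    (hA : A.IsHermitian) (f : V →ₗ[ℝ] n → ℝ) (hf : Function.Injective f)
    (hnonneg : ∀ v, 0 ≤ f v ⬝ᵥ A *ᵥ f v) :
    Module.finrank ℝ V ≤ (Finset.univ.filter fun i => 0 ≤ hA.eigenvalues i).card := by
  set U : Matrix n n ℝ := (hA.eigenvectorUnitary : Matrix n n ℝ)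
  have hU : U * star U = 1 := Unitary.coe_mul_star_self hA.eigenvectorUnitary
  have hspec : A = U * diagonal hA.eigenvalues * star U := by
    simpa [Unitary.conjStarAlgAut_apply, Function.comp_def] using hA.spectral_theorem
  have hquad (x : n → ℝ) :
      x ⬝ᵥ A *ᵥ x = ∑ i, hA.eigenvalues i * ((star U *ᵥ x) i) ^ 2 := by
    have hx : x ᵥ* U = star U *ᵥ x := by
      rw [star_eq_conjTranspose, conjTranspose_eq_transpose_of_trivial, mulVec_transpose]
    conv_lhs => rw [hspec]
    rw [← mulVec_mulVec, ← mulVec_mulVec, dotProduct_mulVec, hx, dotProduct]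
    refine Finset.sum_congr rfl fun i _ => ?_
    rw [mulVec_diagonal]
    ring
  let s := Finset.univ.filter fun i => 0 ≤ hA.eigenvalues i
  let g : V →ₗ[ℝ] s → ℝ := LinearMap.funLeft ℝ ℝ Subtype.val ∘ₗ (star U).mulVecLin ∘ₗ f
  have hg : Function.Injective g := by
    rw [injective_iff_map_eq_zero]
    intro v hv
    have hzero (i : n) (hi : 0 ≤ hA.eigenvalues i) : (star U *ᵥ f v) i = 0 :=
      congrFun hv ⟨i, by simpa [s] using hi⟩
    have hterm (i : n) : hA.eigenvalues i * ((star U *ᵥ f v) i) ^ 2 ≤ 0 := by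
      rcases le_or_gt 0 (hA.eigenvalues i) with hi | hi
      · simp [hzero i hi]
      · exact mul_nonpos_of_nonpos_of_nonneg hi.le (sq_nonneg _)
    have hsum : ∑ i, hA.eigenvalues i * ((star U *ᵥ f v) i) ^ 2 = 0 :=
      le_antisymm (Finset.sum_nonpos fun i _ => hterm i) (hquad (f v) ▸ hnonneg v)
    have hcoord : star U *ᵥ f v = 0 := by
      funext i
      rcases le_or_gt 0 (hA.eigenvalues i) with hi | hi
      · exact hzero i hi
      · have := (Finset.sum_eq_zero_iff_of_nonpos fun i _ => hterm i).1 hsum i (Finset.mem_univ i)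
        simpa [hi.ne] using this
    have hfv : f v = 0 := by
      rw [← one_mulVec (f v), ← hU, ← mulVec_mulVec, hcoord, mulVec_zero]
    exact hf (hfv.trans (map_zero f).symm)
  simpa only [Module.finrank_fintype_fun_eq_card, Fintype.card_coe] using
    LinearMap.finrank_le_finrank_of_injective hg

/-- For every integer `m ≥ 6`, the `m × m` real symmetric matrix `A` with
`A 0 0 = 10`, `A 0 j = A j 0 = 4` for `1 ≤ j ≤ m-1`, `A j j = 0` for `1 ≤ j ≤ m-1`,
and `A i j = 2` for distinct `i, j ≥ 1`, has at least two nonnegative eigenvalues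
(counted with multiplicity). -/
theorem stmt_0 (m : ℕ) (hm : 6 ≤ m)
    (A : Matrix (Fin m) (Fin m) ℝ)
    (hA_def : A = Matrix.of fun i j : Fin m =>
      if i.val = 0 ∧ j.val = 0 then (10 : ℝ)
      else if i.val = 0 ∨ j.val = 0 then 4
      else if i = j then 0 else 2)
    (hA : A.IsHermitian) :
    2 ≤ (Finset.univ.filter fun i : Fin m => 0 ≤ hA.eigenvalues i).card := by
  obtain ⟨k, rfl⟩ : ∃ k, m = k + 1 := ⟨m - 1, by omega⟩
  have hk : (5 : ℝ) ≤ k := by exact_mod_cast (by omega : 5 ≤ k)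
  let f : ℝ × ℝ →ₗ[ℝ] Fin (k + 1) → ℝ :=
    { toFun := fun p => Fin.cons p.1 fun _ => p.2
      map_add' := fun p q => by funext i; cases i using Fin.cases <;> simp
      map_smul' := fun c p => by funext i; cases i using Fin.cases <;> simp }
  have hf : Function.Injective f := fun p q h =>
    Prod.ext (congrFun h 0) (congrFun h (Fin.succ ⟨0, by omega⟩))
  have hmul (p : ℝ × ℝ) : A.mulVec (f p) =
      Fin.cons (10 * p.1 + 4 * k * p.2) fun _ => 4 * p.1 + 2 * (k - 1) * p.2 := by
    have hsum (i : Fin k) : ∑ j, (if i = j then 0 else 2 * p.2) = 2 * (k - 1) * p.2 := by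
      have hsplit (j : Fin k) :
          (if i = j then 0 else 2 * p.2) = 2 * p.2 - if i = j then 2 * p.2 else 0 := by
        split_ifs <;> simp
      simp only [hsplit, Finset.sum_sub_distrib, Finset.sum_ite_eq, Finset.mem_univ, if_true,
        Finset.sum_const, Finset.card_univ, Fintype.card_fin, nsmul_eq_mul]
      ring
    funext i
    cases i using Fin.cases with
    | zero =>
      simp [hA_def, f, Matrix.mulVec, dotProduct, Fin.sum_univ_succ]
      ring
    | succ i =>
      simp [hA_def, f, Matrix.mulVec, dotProduct, Fin.sum_univ_succ, hsum]
  have hnonneg (p : ℝ × ℝ) : 0 ≤ f p ⬝ᵥ A.mulVec (f p) := by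
    have hform : f p ⬝ᵥ A.mulVec (f p) =
        10 * (p.1 + 2 / 5 * k * p.2) ^ 2 + 2 / 5 * (k * (k - 5)) * p.2 ^ 2 := by
      rw [hmul]
      simp [f, dotProduct, Fin.sum_univ_succ]
      ring
    have : (0 : ℝ) ≤ k * (k - 5) := mul_nonneg (by linarith) (by linarith)
    rw [hform]
    positivity
  simpa using hA.finrank_le_card_nonneg_eigenvalues f hf hnonneg
end

section
/- For every integer m ≥ 11, the m×m real symmetric matrix A (rows and columns indexed by 0,…,m−1) with entries A₀₀ = 14, A₀ⱼ = Aⱼ₀ = 5 for 1 ≤ j ≤ m−1, Aⱼⱼ = 0 for 1 ≤ j ≤ m−1, and Aᵢⱼ = 2 for all distinct i, j with 1 ≤ i, j ≤ m−1, has at least two positive eigenvalues (eigenvalues counted with multiplicity as a real symmetric matrix). -/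
open Matrix in
/-- The quadratic form of a real symmetric matrix, in coordinates with respect to an
orthonormal eigenbasis. -/
theorem Matrix.IsHermitian.dotProduct_mulVec_eq_sum_eigenvalues {n : Type*} [Fintype n]
    [DecidableEq n] {A : Matrix n n ℝ} (hA : A.IsHermitian) (x : n → ℝ) :
    x ⬝ᵥ A *ᵥ x = ∑ i, hA.eigenvalues i *
      (((hA.eigenvectorUnitary : Matrix n n ℝ)ᵀ *ᵥ x) i) ^ 2 := by
  conv_lhs => rw [hA.spectral_theorem, Unitary.conjStarAlgAut_apply]
  rw [← mulVec_mulVec, ← mulVec_mulVec, dotProduct_mulVec, ← mulVec_transpose]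
  simp only [star_eq_conjTranspose, conjTranspose_eq_transpose_of_trivial, dotProduct,
    mulVec_diagonal, Function.comp_apply, RCLike.ofReal_real_eq_id, id_eq]
  exact Finset.sum_congr rfl fun i _ => by ring

open Matrix in
/-- If the quadratic form of a real symmetric matrix pulls back to a positive definite form
on `V`, then the matrix has at least `dim V` positive eigenvalues. -/
theorem Matrix.IsHermitian.finrank_le_card_pos_eigenvalues {n V : Type*} [Fintype n]
    [DecidableEq n] [AddCommGroup V] [Module ℝ V] {A : Matrix n n ℝ} (hA : A.IsHermitian)
    (f : V →ₗ[ℝ] n → ℝ) (hf : ∀ v, v ≠ 0 → 0 < f v ⬝ᵥ A *ᵥ f v) :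
    Module.finrank ℝ V ≤ (Finset.univ.filter fun i => 0 < hA.eigenvalues i).card := by
  let g : V →ₗ[ℝ] {i // 0 < hA.eigenvalues i} → ℝ :=
    LinearMap.funLeft ℝ ℝ Subtype.val ∘ₗ
      (hA.eigenvectorUnitary : Matrix n n ℝ)ᵀ.mulVecLin ∘ₗ f
  have hg : Function.Injective g := by
    refine (injective_iff_map_eq_zero g).2 fun v hv => ?_
    by_contra hne
    refine (hf v hne).not_ge ?_
    rw [hA.dotProduct_mulVec_eq_sum_eigenvalues]
    refine Finset.sum_nonpos fun i _ => ?_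
    by_cases hi : 0 < hA.eigenvalues i
    · have hvi : ((hA.eigenvectorUnitary : Matrix n n ℝ)ᵀ *ᵥ f v) i = 0 := congrFun hv ⟨i, hi⟩
      simp [hvi]
    · exact mul_nonpos_of_nonpos_of_nonneg (not_lt.1 hi) (sq_nonneg _)
  simpa [Fintype.card_subtype] using LinearMap.finrank_le_finrank_of_injective hg

/-- For every integer `m ≥ 11`, the `m × m` real symmetric matrix `A` with
`A 0 0 = 14`, `A 0 j = A j 0 = 5` for `1 ≤ j ≤ m-1`, `A j j = 0` for `1 ≤ j ≤ m-1`,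
and `A i j = 2` for distinct `i, j ≥ 1`, has at least two positive eigenvalues
(counted with multiplicity). -/
theorem stmt_3 (m : ℕ) (hm : 11 ≤ m)
    (A : Matrix (Fin m) (Fin m) ℝ)
    (hA_def : A = Matrix.of fun i j : Fin m =>
      if i.val = 0 ∧ j.val = 0 then (14 : ℝ)
      else if i.val = 0 ∨ j.val = 0 then 5
      else if i = j then 0 else 2)
    (hA : A.IsHermitian) :
    2 ≤ (Finset.univ.filter fun i : Fin m => 0 < hA.eigenvalues i).card := by
  obtain ⟨n, rfl⟩ : ∃ n, m = n + 1 := ⟨m - 1, by lia⟩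
  have hn : (10 : ℝ) ≤ n := by exact_mod_cast (by lia : 10 ≤ n)
  let f : ℝ × ℝ →ₗ[ℝ] Fin (n + 1) → ℝ :=
    { toFun := fun p => Fin.cons p.1 fun _ => p.2
      map_add' := fun p q => by ext i; cases i using Fin.cases <;> simp
      map_smul' := fun c p => by ext i; cases i using Fin.cases <;> simp }
  have hform : ∀ a b : ℝ, f (a, b) ⬝ᵥ A.mulVec (f (a, b)) =
      14 * a ^ 2 + 10 * n * a * b + 2 * n * (n - 1) * b ^ 2 := by
    intro a b
    have hoff : ∀ i : Fin n, ∑ j : Fin n, (if i = j then (0 : ℝ) else 2 * b) =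
        2 * (n - 1) * b := by
      intro i
      have hsub : ∀ j : Fin n, (if i = j then (0 : ℝ) else 2 * b) =
          2 * b - if i = j then 2 * b else 0 := fun j => by split_ifs <;> ring
      simp only [hsub, Finset.sum_sub_distrib, Finset.sum_ite_eq, Finset.mem_univ, if_true,
        Finset.sum_const, Finset.card_univ, Fintype.card_fin, nsmul_eq_mul]
      ring
    simp [f, hA_def, dotProduct, Matrix.mulVec, Fin.sum_univ_succ, hoff, mul_add]
    ring
  have hpos : ∀ p : ℝ × ℝ, p ≠ 0 → 0 < f p ⬝ᵥ A.mulVec (f p) := by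
    rintro ⟨a, b⟩ hp
    rw [hform]
    by_cases hb : b = 0
    · subst hb
      have ha : a ≠ 0 := fun h => hp (by simp [h])
      have := pow_pos (abs_pos.2 ha) 2
      rw [sq_abs] at this
      linarith
    · have hdet : 0 < (n : ℝ) * (3 * n - 28) * b ^ 2 :=
        mul_pos (mul_pos (by linarith) (by linarith)) (sq_pos_of_ne_zero hb)
      linarith [sq_nonneg (14 * a + 5 * n * b)]
  simpa using hA.finrank_le_card_pos_eigenvalues f hpos
end

section
/- For every integer i with 1 ≤ i ≤ 9, the (i+1)×(i+1) real symmetric matrix 𝔑ᵢ (rows and columns indexed by 0,…,i) with entries (𝔑ᵢ)₀₀ = 14, (𝔑ᵢ)₀ⱼ = (𝔑ᵢ)ⱼ₀ = 5 for 1 ≤ j ≤ i, (𝔑ᵢ)ⱼⱼ = 0 for 1 ≤ j ≤ i, and (𝔑ᵢ)ⱼₖ = 2 for all distinct j, k with 1 ≤ j, k ≤ i, has exactly one positive eigenvalue and exactly i negative eigenvalues (eigenvalues counted with multiplicity); in particular 𝔑ᵢ is nondegenerate. -/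
open scoped Matrix

open Matrix in
/-- If a real symmetric matrix is negative definite on the hyperplane orthogonal to `w`, then it
has at most one nonnegative eigenvalue. -/
theorem Matrix.IsHermitian.eq_of_eigenvalues_nonneg_of_neg_on_hyperplane
    {n : Type*} [Fintype n] [DecidableEq n] {A : Matrix n n ℝ} (hA : A.IsHermitian) (w : n → ℝ)
    (hw : ∀ x : n → ℝ, x ≠ 0 → w ⬝ᵥ x = 0 → x ⬝ᵥ A *ᵥ x < 0) {j k : n}
    (hj : 0 ≤ hA.eigenvalues j) (hk : 0 ≤ hA.eigenvalues k) : j = k := by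
  by_contra hjk
  have dot_basis (p q : n) : (hA.eigenvectorBasis p).ofLp ⬝ᵥ (hA.eigenvectorBasis q).ofLp =
      if p = q then 1 else 0 := by
    have h := orthonormal_iff_ite.mp hA.eigenvectorBasis.orthonormal q p
    rw [EuclideanSpace.inner_eq_star_dotProduct] at h
    simpa [eq_comm] using h
  have hjj := dot_basis j j
  have hkk := dot_basis k k
  have hjk0 := dot_basis j k
  have hkj0 := dot_basis k j
  have hAj := hA.mulVec_eigenvectorBasis j
  have hAk := hA.mulVec_eigenvectorBasis k
  rw [if_pos rfl] at hjj hkk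
  rw [if_neg hjk] at hjk0
  rw [if_neg (Ne.symm hjk)] at hkj0
  set u : n → ℝ := (hA.eigenvectorBasis j).ofLp
  set v : n → ℝ := (hA.eigenvectorBasis k).ofLp
  have combination_eq_zero (c d : ℝ) (hcd : w ⬝ᵥ (c • u + d • v) = 0) : c • u + d • v = 0 := by
    by_contra hx
    have h := hw _ hx hcd
    simp only [mulVec_add, mulVec_smul, hAj, hAk, add_dotProduct, dotProduct_add, smul_dotProduct,
      dotProduct_smul, hjj, hkk, hjk0, hkj0, smul_eq_mul] at h
    nlinarith [mul_nonneg (sq_nonneg c) hj, mul_nonneg (sq_nonneg d) hk]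
  have hv : w ⬝ᵥ v = 0 := by
    have h := congrArg (u ⬝ᵥ ·) (combination_eq_zero (w ⬝ᵥ v) (-(w ⬝ᵥ u)) (by
      simp only [dotProduct_add, dotProduct_smul, smul_eq_mul]; ring))
    simpa [hjj, hjk0] using h
  have h := congrArg (v ⬝ᵥ ·) (combination_eq_zero 0 1 (by simp [hv]))
  simp [hkk] at h

open Matrix in
/-- A real symmetric matrix of positive trace that is negative definite on a hyperplane has
exactly one positive eigenvalue, all other eigenvalues being negative. -/
theorem Matrix.IsHermitian.exists_eigenvalues_pos_of_neg_on_hyperplane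
    {n : Type*} [Fintype n] [DecidableEq n] {A : Matrix n n ℝ} (hA : A.IsHermitian) (w : n → ℝ)
    (hw : ∀ x : n → ℝ, x ≠ 0 → w ⬝ᵥ x = 0 → x ⬝ᵥ A *ᵥ x < 0) (htr : 0 < A.trace) :
    ∃ j, 0 < hA.eigenvalues j ∧ ∀ k, k ≠ j → hA.eigenvalues k < 0 := by
  have hsum : 0 < ∑ j, hA.eigenvalues j := by
    have h := hA.trace_eq_sum_eigenvalues
    simp only [RCLike.ofReal_real_eq_id, id_eq] at h
    rwa [h] at htr
  obtain ⟨j, -, hj⟩ := Finset.exists_lt_of_sum_lt (s := Finset.univ)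
    (f := fun _ => (0 : ℝ)) (g := hA.eigenvalues) (by simpa using hsum)
  refine ⟨j, hj, fun k hkj => ?_⟩
  by_contra! hk
  exact hkj (hA.eq_of_eigenvalues_nonneg_of_neg_on_hyperplane w hw hk hj.le)

/-- For every integer `i` with `1 ≤ i ≤ 9`, the `(i+1) × (i+1)` real symmetric matrix
`𝔑ᵢ` with `(𝔑ᵢ)₀₀ = 14`, `(𝔑ᵢ)₀ⱼ = (𝔑ᵢ)ⱼ₀ = 5` for `1 ≤ j ≤ i`, `(𝔑ᵢ)ⱼⱼ = 0` for
`1 ≤ j ≤ i`, and `(𝔑ᵢ)ⱼₖ = 2` for distinct `j, k ≥ 1`, has exactly one positive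
eigenvalue and exactly `i` negative eigenvalues (counted with multiplicity); in
particular it is nondegenerate. -/
theorem stmt_4 (i : ℕ) (hi1 : 1 ≤ i) (hi9 : i ≤ 9)
    (N : Matrix (Fin (i + 1)) (Fin (i + 1)) ℝ)
    (hN_def : N = Matrix.of fun j k : Fin (i + 1) =>
      if j.val = 0 ∧ k.val = 0 then (14 : ℝ)
      else if j.val = 0 ∨ k.val = 0 then 5
      else if j = k then 0 else 2)
    (hN : N.IsHermitian) :
    (Finset.univ.filter fun j : Fin (i + 1) => 0 < hN.eigenvalues j).card = 1 ∧
    (Finset.univ.filter fun j : Fin (i + 1) => hN.eigenvalues j < 0).card = i ∧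
    N.det ≠ 0 := by
  have h00 : N 0 0 = 14 := by simp [hN_def]
  have h0s (k : Fin i) : N 0 k.succ = 5 := by simp [hN_def]
  have hs0 (k : Fin i) : N k.succ 0 = 5 := by simp [hN_def]
  have hss (j k : Fin i) : N j.succ k.succ = 2 - if j = k then 2 else 0 := by
    by_cases h : j = k <;> simp [hN_def, h]
  have htr : 0 < N.trace := by
    simp [Matrix.trace, Fin.sum_univ_succ, h00, hss]
  have hneg (x : Fin (i + 1) → ℝ) (hx : x ≠ 0) (hrow : N 0 ⬝ᵥ x = 0) : x ⬝ᵥ N *ᵥ x < 0 := by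
    have hrow' : 14 * x 0 + 5 * ∑ k : Fin i, x k.succ = 0 := by
      simpa [dotProduct, Fin.sum_univ_succ, h00, h0s, Finset.mul_sum] using hrow
    have hQ : x ⬝ᵥ N *ᵥ x = 14 * x 0 ^ 2 + 10 * x 0 * ∑ k : Fin i, x k.succ
        + 2 * (∑ k : Fin i, x k.succ) ^ 2 - 2 * ∑ k : Fin i, x k.succ ^ 2 := by
      have hmul0 : (N *ᵥ x) 0 = 14 * x 0 + 5 * ∑ k : Fin i, x k.succ := by
        simp [Matrix.mulVec, dotProduct, Fin.sum_univ_succ, h00, h0s, Finset.mul_sum]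
      have hmuls (j : Fin i) :
          (N *ᵥ x) j.succ = 5 * x 0 + 2 * ∑ k : Fin i, x k.succ - 2 * x j.succ := by
        simp [Matrix.mulVec, dotProduct, Fin.sum_univ_succ, hs0, hss, sub_mul, ite_mul,
          Finset.mul_sum]
        ring
      have hterm (j : Fin i) : x j.succ * (N *ᵥ x) j.succ =
          x j.succ * (5 * x 0 + 2 * ∑ k : Fin i, x k.succ) - 2 * x j.succ ^ 2 := by
        rw [hmuls]; ring
      rw [dotProduct, Fin.sum_univ_succ, hmul0]
      simp only [hterm, Finset.sum_sub_distrib, ← Finset.sum_mul, ← Finset.mul_sum]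
      ring
    have hcs : (∑ k : Fin i, x k.succ) ^ 2 ≤ i * ∑ k : Fin i, x k.succ ^ 2 := by
      simpa using sq_sum_le_card_mul_sum_sq (s := (Finset.univ : Finset (Fin i)))
        (f := fun k => x k.succ)
    have hq : 0 < ∑ k : Fin i, x k.succ ^ 2 := by
      refine (Finset.sum_nonneg fun k _ => sq_nonneg _).lt_of_ne' fun h => hx ?_
      have hs (k : Fin i) : x k.succ = 0 := by
        simpa using (Finset.sum_eq_zero_iff_of_nonneg fun k _ => sq_nonneg _).mp h k
          (Finset.mem_univ k)
      have h0 : x 0 = 0 := by simpa [hs] using hrow'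
      exact funext (Fin.cases h0 hs)
    have hi : (i : ℝ) ≤ 9 := by exact_mod_cast hi9
    have hx0 : x 0 = -(5 / 14) * ∑ k : Fin i, x k.succ := by linarith
    rw [hQ, hx0]
    nlinarith [mul_le_mul_of_nonneg_right hi hq.le]
  obtain ⟨j, hj, hne⟩ := hN.exists_eigenvalues_pos_of_neg_on_hyperplane (N 0) hneg htr
  have hpos_iff (k) : 0 < hN.eigenvalues k ↔ k = j :=
    ⟨fun h => by_contra fun hk => (hne k hk).not_gt h, fun h => h ▸ hj⟩
  have hneg_iff (k) : hN.eigenvalues k < 0 ↔ k ≠ j :=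
    ⟨fun h hk => (hk ▸ h).not_gt hj, hne k⟩
  refine ⟨?_, ?_, ?_⟩
  · simp [hpos_iff, Finset.filter_eq']
  · simp [hneg_iff, Finset.filter_ne']
  · rw [hN.det_eq_prod_eigenvalues]
    refine Finset.prod_ne_zero_iff.mpr fun k _ => ?_
    rcases eq_or_ne k j with rfl | hk
    · exact_mod_cast hj.ne'
    · exact_mod_cast (hne k hk).ne
end
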